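/- Assume hypotheses (H3) and (H6). For 1 ≤ i ≤ m let d_i denote the total degree of R_i and let R_i^{d_i} be the homogeneous component of R_i of degree d_i. Then the set {x ∈ K^r : R_1^{d_1}(x) = ⋯ = R_m^{d_m}(x) = 0 and the m×r Jacobian matrix ((∂R_i^{d_i}/∂X_j)(x))_{1≤i≤m,1≤j≤r} has rank strictly less than m} has dimension at most r−m−1, i.e. it has codimension at least one in the affine cone {x ∈ K^r : R_1^{d_1}(x) = ⋯ = R_m^{d_m}(x) = 0}. -/

import Mathlib

open MvPolynomial Polynomial
open scoped Classical

noncomputable section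

/-- The monic polynomial `T^r + a_{r-1} T^{r-1} + ⋯ + a_0` attached to a coefficient
vector `a : Fin r → K` (where `a j` is the coefficient of `T^j`). -/
def monicOfCoeffs {K : Type*} [CommRing K] (r : ℕ) (a : Fin r → K) : Polynomial K :=
  Polynomial.X ^ r + ∑ j : Fin r, Polynomial.C (a j) * Polynomial.X ^ (j : ℕ)

/-- The vanishing ideal of a subset `Z ⊆ K^r`. -/
def vanishingIdealOf (K : Type*) [CommRing K] (r : ℕ) (Z : Set (Fin r → K)) :
    Ideal (MvPolynomial (Fin r) K) where
  carrier := {p | ∀ x ∈ Z, MvPolynomial.eval x p = 0}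
  add_mem' := by
    intro a b ha hb x hx
    simp [map_add, ha x hx, hb x hx]
  zero_mem' := by intro x hx; simp
  smul_mem' := by
    intro c p hp x hx
    simp [smul_eq_mul, map_mul, hp x hx]

/-- The dimension of a subset `Z ⊆ K^r`: the Krull dimension of the quotient of the
polynomial ring over `K` by the vanishing ideal of `Z`. -/
def dimOf (K : Type*) [CommRing K] (r : ℕ) (Z : Set (Fin r → K)) : WithBot ℕ∞ :=
  ringKrullDim (MvPolynomial (Fin r) K ⧸ vanishingIdealOf K r Z)

/-- `f` has factorization pattern `λ = (λ_1, …, λ_r)`: for each `i`, exactly `λ_i` of the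
monic irreducible factors of `f` over `F_q` (counted with multiplicity) have degree `i`.
(The index `i : Fin r` corresponds to the degree `i + 1`.) -/
def HasFactorizationPattern {Fq : Type*} [Field Fq] {r : ℕ}
    (f : Polynomial Fq) (lam : Fin r → ℕ) : Prop :=
  ∀ i : Fin r,
    ((UniqueFactorizationMonoid.normalizedFactors f).filter
      (fun g => g.natDegree = (i : ℕ) + 1)).card = lam i

end

/-- The coefficient of `T^j` in `∏ i, (T - X_i)`, as a polynomial in the roots `X_i`. -/
noncomputable def vietaCoeff (R : Type*) [CommRing R] (r : ℕ) (j : Fin r) :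
    MvPolynomial (Fin r) R :=
  (-1) ^ (r - (j : ℕ)) * MvPolynomial.esymm (Fin r) R (r - (j : ℕ))

theorem map_vietaCoeff {R S : Type*} [CommRing R] [CommRing S] (f : R →+* S) (r : ℕ)
    (j : Fin r) : MvPolynomial.map f (vietaCoeff R r j) = vietaCoeff S r j := by
  simp [vietaCoeff, MvPolynomial.map_esymm]

theorem isHomogeneous_vietaCoeff (R : Type*) [CommRing R] (r : ℕ) (j : Fin r) :
    (vietaCoeff R r j).IsHomogeneous (r - (j : ℕ)) := by
  have h1 : ((-1 : MvPolynomial (Fin r) R) ^ (r - (j : ℕ))).IsHomogeneous 0 := by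
    simpa using (MvPolynomial.isHomogeneous_C (Fin r) (-1 : R)).pow (r - (j : ℕ))
  have h2 : (MvPolynomial.esymm (Fin r) R (r - (j : ℕ))).IsHomogeneous (r - (j : ℕ)) := by
    refine MvPolynomial.IsHomogeneous.sum _ _ _ fun t ht => ?_
    have := MvPolynomial.IsHomogeneous.prod t (fun i => (MvPolynomial.X i : MvPolynomial (Fin r) R))
      (fun _ => 1) fun i _ => MvPolynomial.isHomogeneous_X R i
    simpa [(Finset.mem_powersetCard.1 ht).2] using this
  simpa [vietaCoeff] using h1.mul h2

theorem monicOfCoeffs_vietaCoeff {R A : Type*} [CommRing R] [CommRing A] [Algebra R A] {r : ℕ}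
    (x : Fin r → A) :
    monicOfCoeffs r (fun j => MvPolynomial.aeval x (vietaCoeff R r j)) =
      ∏ i, (Polynomial.X - Polynomial.C (x i)) := by
  have h := Multiset.prod_X_sub_X_eq_sum_esymm (Finset.univ.val.map x)
  rw [Multiset.map_map] at h
  change ∏ i, (Polynomial.X - Polynomial.C (x i)) = _ at h
  rw [h, monicOfCoeffs]
  simp only [Multiset.card_map, Finset.card_val, Finset.card_univ, Fintype.card_fin]
  rw [← Finset.sum_range_reflect, Finset.sum_range_succ, add_comm, Finset.sum_range]
  refine congrArg₂ (· + ·) ?_ ?_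
  · refine Finset.sum_congr rfl fun j _ => ?_
    have e1 : r + 1 - 1 - (j : ℕ) = r - j := by omega
    have e2 : r - (r - (j : ℕ)) = j := by omega
    rw [e1, e2, vietaCoeff, map_mul, MvPolynomial.aeval_esymm_eq_multiset_esymm]
    simp [mul_assoc]
  · simp [Multiset.esymm]

theorem eval_monicOfCoeffs {A : Type*} [CommRing A] {r : ℕ} (a : Fin r → A) (t : A) :
    (monicOfCoeffs r a).eval t = t ^ r + ∑ j, a j * t ^ (j : ℕ) := by
  simp [monicOfCoeffs, Polynomial.eval_finsetSum]

theorem eval_derivative_monicOfCoeffs {A : Type*} [CommRing A] {r : ℕ} (a : Fin r → A) (t : A) :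
    (monicOfCoeffs r a).derivative.eval t =
      r * t ^ (r - 1) + ∑ j, a j * (((j : ℕ) : A) * t ^ ((j : ℕ) - 1)) := by
  simp [monicOfCoeffs, Polynomial.eval_finsetSum, Polynomial.derivative_X_pow]

theorem algebraicIndependent_vietaCoeff (R : Type*) [CommRing R] (r : ℕ) :
    AlgebraicIndependent R (vietaCoeff R r) := by
  have h1 : Function.Injective (MvPolynomial.aeval (R := R)
      fun i : Fin r => MvPolynomial.esymm (Fin r) R (i + 1)) := fun p q h =>
    MvPolynomial.esymmAlgHom_injective R (σ := Fin r) (n := r) (by simp)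
      (Subtype.ext (by simpa only [MvPolynomial.esymmAlgHom_apply] using h))
  let g : MvPolynomial (Fin r) R →ₐ[R] MvPolynomial (Fin r) R :=
    MvPolynomial.aeval fun j => (-1) ^ (r - (j : ℕ)) * MvPolynomial.X j
  have hg : Function.Injective g := by
    refine Function.LeftInverse.injective (g := g) fun p => ?_
    have : g.comp g = AlgHom.id R _ := by
      refine MvPolynomial.algHom_ext fun j => ?_
      simp only [g, AlgHom.comp_apply, MvPolynomial.aeval_X, map_mul, map_pow, map_neg, map_one,
        AlgHom.id_apply]
      rw [← mul_assoc, ← mul_pow]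
      simp
    exact DFunLike.congr_fun this p
  have h3 : MvPolynomial.aeval (R := R) (vietaCoeff R r) =
      ((MvPolynomial.aeval (R := R) fun i : Fin r => MvPolynomial.esymm (Fin r) R (i + 1)).comp
        (MvPolynomial.rename Fin.rev)).comp g := by
    refine MvPolynomial.algHom_ext fun j => ?_
    have : r - (j + 1) + 1 = r - (j : ℕ) := by omega
    simp [g, vietaCoeff, this]
  change Function.Injective (MvPolynomial.aeval (R := R) (vietaCoeff R r))
  rw [h3]
  exact (h1.comp (MvPolynomial.rename_injective _ Fin.rev_injective)).comp hg

theorem homogeneousComponent_aeval {R σ τ : Type*} [CommRing R] (w : σ → ℕ)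
    (s : σ → MvPolynomial τ R) (hs : ∀ j, (s j).IsHomogeneous (w j)) (n : ℕ)
    (p : MvPolynomial σ R) :
    MvPolynomial.homogeneousComponent n (MvPolynomial.aeval s p) =
      MvPolynomial.aeval s (MvPolynomial.weightedHomogeneousComponent w n p) := by
  induction p using MvPolynomial.induction_on' with
  | add p q hp hq => rw [map_add, map_add, hp, hq, map_add, map_add]
  | monomial u c =>
    have hu : (MvPolynomial.aeval s (MvPolynomial.monomial u c)).IsHomogeneous
        (Finsupp.weight w u) := by
      rw [MvPolynomial.aeval_monomial, MvPolynomial.algebraMap_eq]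
      refine MvPolynomial.IsHomogeneous.C_mul ?_ c
      have := MvPolynomial.IsHomogeneous.prod u.support (fun j => s j ^ u j)
        (fun j => w j * u j) fun j _ => (hs j).pow (u j)
      convert! this using 1
      simp [Finsupp.weight_apply, Finsupp.sum, mul_comm]
    rw [MvPolynomial.homogeneousComponent_of_mem hu,
      MvPolynomial.weightedHomogeneousComponent_of_mem
        (MvPolynomial.isWeightedHomogeneous_monomial w u c rfl)]
    split_ifs <;> simp

theorem homogeneousComponent_totalDegree_aeval {R σ τ : Type*} [CommRing R] (w : σ → ℕ)
    (s : σ → MvPolynomial τ R) (hs : ∀ j, (s j).IsHomogeneous (w j))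
    (hinj : AlgebraicIndependent R s) (p : MvPolynomial σ R) :
    MvPolynomial.homogeneousComponent (MvPolynomial.aeval s p).totalDegree
        (MvPolynomial.aeval s p) =
      MvPolynomial.aeval s (MvPolynomial.weightedHomogeneousComponent w
        (MvPolynomial.weightedTotalDegree w p) p) := by
  rw [homogeneousComponent_aeval w s hs]
  rcases eq_or_ne p 0 with rfl | hp
  · simp
  suffices h : (MvPolynomial.aeval s p).totalDegree = MvPolynomial.weightedTotalDegree w p by
    rw [h]
  refine le_antisymm (not_lt.1 fun hlt => ?_) ?_
  · have hne : MvPolynomial.aeval s p ≠ 0 := fun h0 => hp (hinj (h0.trans (map_zero _).symm))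
    have h0 : MvPolynomial.homogeneousComponent (MvPolynomial.aeval s p).totalDegree
        (MvPolynomial.aeval s p) = 0 := by
      rw [homogeneousComponent_aeval w s hs,
        MvPolynomial.weightedHomogeneousComponent_eq_zero _ _ hlt, map_zero]
    obtain ⟨u, hu, hmax⟩ := Finset.exists_mem_eq_sup _ (MvPolynomial.support_nonempty.2 hne)
      fun u : τ →₀ ℕ => u.sum fun _ e => e
    have hc := congrArg (MvPolynomial.coeff u) h0
    rw [MvPolynomial.coeff_homogeneousComponent, if_pos, MvPolynomial.coeff_zero] at hc
    · exact MvPolynomial.mem_support_iff.1 hu hc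
    · exact hmax.symm
  · refine not_lt.1 fun hlt => ?_
    have h0 := MvPolynomial.homogeneousComponent_eq_zero _ _ hlt
    rw [homogeneousComponent_aeval w s hs] at h0
    have h1 := hinj (h0.trans (map_zero _).symm)
    obtain ⟨u, hu, hmax⟩ := Finset.exists_mem_eq_sup _ (MvPolynomial.support_nonempty.2 hp)
      fun u : σ →₀ ℕ => Finsupp.weight w u
    have hc := congrArg (MvPolynomial.coeff u) h1
    rw [MvPolynomial.coeff_weightedHomogeneousComponent, if_pos, MvPolynomial.coeff_zero] at hc
    · exact MvPolynomial.mem_support_iff.1 hu hc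
    · exact hmax.symm

theorem eval_aeval {R σ τ : Type*} [CommRing R] (s : σ → MvPolynomial τ R) (x : τ → R)
    (p : MvPolynomial σ R) :
    MvPolynomial.eval x (MvPolynomial.aeval s p) =
      MvPolynomial.eval (fun j => MvPolynomial.eval x (s j)) p :=
  MvPolynomial.comp_aeval_apply s (MvPolynomial.aeval x) p

theorem map_aeval_eq {R S σ τ : Type*} [CommRing R] [CommRing S] (f : R →+* S)
    (s : σ → MvPolynomial τ R) (p : MvPolynomial σ R) :
    MvPolynomial.map f (MvPolynomial.aeval s p) =
      MvPolynomial.aeval (fun j => MvPolynomial.map f (s j)) (MvPolynomial.map f p) :=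
  MvPolynomial.map_bind₁ f s p

theorem pderiv_aeval {R σ τ : Type*} [CommRing R] [Fintype σ]
    (s : σ → MvPolynomial τ R) (p : MvPolynomial σ R) (i : τ) :
    MvPolynomial.pderiv i (MvPolynomial.aeval s p) =
      ∑ j, MvPolynomial.aeval s (MvPolynomial.pderiv j p) * MvPolynomial.pderiv i (s j) := by
  induction p using MvPolynomial.induction_on with
  | C c => simp [MvPolynomial.algebraMap_eq]
  | add p q hp hq => simp only [map_add, hp, hq, add_mul, Finset.sum_add_distrib]
  | mul_X p j hp =>
    simp only [map_mul, MvPolynomial.aeval_X, Derivation.leibniz, hp, smul_eq_mul, map_add,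
      MvPolynomial.pderiv_X, add_mul, Finset.sum_add_distrib, Finset.mul_sum]
    congr 1
    · rw [Finset.sum_eq_single j] <;> simp +contextual
    · exact Finset.sum_congr rfl fun _ _ => by ring

theorem injective_of_squarefree_prod_X_sub_C {K ι : Type*} [Field K] [Fintype ι] (x : ι → K)
    (h : Squarefree (∏ i, (Polynomial.X - Polynomial.C (x i)))) : Function.Injective x := by
  intro i j hij
  by_contra hne
  have hdvd := Finset.prod_dvd_prod_of_subset {i, j} Finset.univ
    (fun l => Polynomial.X - Polynomial.C (x l)) (Finset.subset_univ _)
  rw [Finset.prod_pair hne, ← hij] at hdvd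
  exact Polynomial.not_isUnit_X_sub_C _ (h _ hdvd)

/-- The Jacobian matrix of the map sending the roots to the coefficients is invertible at every
point with pairwise distinct coordinates. -/
theorem isUnit_det_jacobian_vietaCoeff {K : Type*} [Field K] {r : ℕ} (x : Fin r → K)
    (hx : Function.Injective x) :
    IsUnit (Matrix.of fun j i : Fin r =>
      MvPolynomial.eval x (MvPolynomial.pderiv i (vietaCoeff K r j))).det := by
  set a : Fin r → K := fun j => MvPolynomial.aeval x (vietaCoeff K r j) with ha
  have hprod := monicOfCoeffs_vietaCoeff (R := K) x
  have hne (l : Fin r) : (monicOfCoeffs r a).derivative.eval (x l) ≠ 0 := by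
    have hsep : (monicOfCoeffs r a).Separable := by
      rw [ha, hprod]; exact Polynomial.separable_prod_X_sub_C_iff.2 hx
    refine hsep.eval₂_derivative_ne_zero (RingHom.id K) (x := x l) ?_
    change (monicOfCoeffs r a).eval (x l) = 0
    rw [ha, hprod, Polynomial.eval_prod]
    exact Finset.prod_eq_zero (Finset.mem_univ l) (by simp)
  have hrel (l : Fin r) : (MvPolynomial.X l : MvPolynomial (Fin r) K) ^ r +
      ∑ j, vietaCoeff K r j * MvPolynomial.X l ^ (j : ℕ) = 0 := by
    have h := congrArg (Polynomial.eval (MvPolynomial.X l : MvPolynomial (Fin r) K))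
      (monicOfCoeffs_vietaCoeff (R := K) (MvPolynomial.X : Fin r → MvPolynomial (Fin r) K))
    rw [eval_monicOfCoeffs, Polynomial.eval_prod,
      Finset.prod_eq_zero (Finset.mem_univ l) (by simp)] at h
    simpa using h
  have hmul : Matrix.vandermonde x * (Matrix.of fun j i : Fin r =>
      MvPolynomial.eval x (MvPolynomial.pderiv i (vietaCoeff K r j))) =
      Matrix.diagonal fun l => -(monicOfCoeffs r a).derivative.eval (x l) := by
    ext l i
    have h := congrArg (fun p => MvPolynomial.eval x (MvPolynomial.pderiv i p)) (hrel l)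
    simp only [map_add, map_sum, MvPolynomial.pderiv_pow, Derivation.leibniz, smul_eq_mul,
      map_mul, map_pow, MvPolynomial.eval_X, map_natCast, map_zero, Finset.sum_add_distrib,
      MvPolynomial.pderiv_X] at h
    rw [Matrix.mul_apply, Matrix.diagonal_apply, eval_derivative_monicOfCoeffs]
    simp only [Matrix.vandermonde_apply, Matrix.of_apply]
    have ha' (j : Fin r) : MvPolynomial.eval x (vietaCoeff K r j) = a j := rfl
    simp only [ha'] at h
    split_ifs with hli
    · subst hli
      simp only [Pi.single_eq_same, map_one, mul_one] at h
      linear_combination h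
    · simpa [Pi.single_eq_of_ne hli] using h
  have hdet := congrArg Matrix.det hmul
  rw [Matrix.det_mul, Matrix.det_diagonal] at hdet
  refine isUnit_iff_ne_zero.2 fun h0 => ?_
  rw [h0, mul_zero] at hdet
  exact Finset.prod_ne_zero_iff.2 (fun l _ => neg_ne_zero.2 (hne l)) hdet.symm

theorem rank_le_rank_mul_submatrix {K m n ι : Type*} [Field K] [Fintype n] [DecidableEq n]
    [Fintype ι] [DecidableEq ι] (A : Matrix m ι K) (M : Matrix n n K) (hM : IsUnit M.det)
    (e : ι → n) (he : Function.Injective e) : A.rank ≤ (A * M.submatrix e id).rank := by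
  have h : M.submatrix e id * M⁻¹.submatrix id e = 1 := by
    rw [← Matrix.submatrix_mul _ _ _ _ _ Function.bijective_id, Matrix.mul_nonsing_inv _ hM,
      Matrix.submatrix_one _ he]
  calc A.rank = (A * M.submatrix e id * M⁻¹.submatrix id e).rank := by
        rw [Matrix.mul_assoc, h, Matrix.mul_one]
    _ ≤ _ := Matrix.rank_mul_le_left _ _

/-- Passing from coefficients to pairwise distinct roots does not decrease the rank of the Jacobian
matrix of a family of polynomials. -/
theorem rank_jacobian_le_rank_jacobian_aeval_vietaCoeff {K : Type*} [Field K] {r m : ℕ} {k : Fin r}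
    (g : Fin m → MvPolynomial {j : Fin r // j ≠ k} K) (x : Fin r → K)
    (hx : Function.Injective x) :
    (Matrix.of fun (i : Fin m) (j : {j : Fin r // j ≠ k}) =>
      MvPolynomial.eval (fun j' : {j : Fin r // j ≠ k} =>
        MvPolynomial.eval x (vietaCoeff K r j'.1)) (MvPolynomial.pderiv j (g i))).rank ≤
    (Matrix.of fun (i : Fin m) (j : Fin r) =>
      MvPolynomial.eval x (MvPolynomial.pderiv j (MvPolynomial.aeval
        (fun j' : {j : Fin r // j ≠ k} => vietaCoeff K r j'.1) (g i)))).rank := by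
  have h : (Matrix.of fun (i : Fin m) (j : Fin r) =>
      MvPolynomial.eval x (MvPolynomial.pderiv j (MvPolynomial.aeval
        (fun j' : {j : Fin r // j ≠ k} => vietaCoeff K r j'.1) (g i)))) =
      (Matrix.of fun (i : Fin m) (j : {j : Fin r // j ≠ k}) =>
        MvPolynomial.eval (fun j' : {j : Fin r // j ≠ k} =>
          MvPolynomial.eval x (vietaCoeff K r j'.1)) (MvPolynomial.pderiv j (g i))) *
      (Matrix.of fun j i : Fin r => MvPolynomial.eval x
        (MvPolynomial.pderiv i (vietaCoeff K r j))).submatrix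
          (fun j : {j : Fin r // j ≠ k} => j.1) id := by
    ext i j
    simp only [Matrix.mul_apply, Matrix.of_apply, Matrix.submatrix_apply, id_eq, pderiv_aeval,
      map_sum, map_mul, eval_aeval]
  rw [h]
  exact rank_le_rank_mul_submatrix _ _ (isUnit_det_jacobian_vietaCoeff x hx) _
    Subtype.val_injective

theorem ringKrullDim_le_of_isIntegral {R S : Type*} [CommRing R] [CommRing S] (f : R →+* S)
    (hf : f.IsIntegral) : ringKrullDim S ≤ ringKrullDim R := by
  let _ := f.toAlgebra
  have : Algebra.IsIntegral R S := ⟨hf⟩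
  refine Order.krullDim_le_of_strictMono (PrimeSpectrum.comap f) fun I J hIJ => ?_
  exact Ideal.IsIntegral.comap_lt_comap (R := R) (I := I.asIdeal) (J := J.asIdeal) hIJ

theorem isIntegral_aeval_vietaCoeff (R : Type*) [CommRing R] (r : ℕ) :
    (MvPolynomial.aeval (R := R) (vietaCoeff R r)).toRingHom.IsIntegral := by
  set φ := (MvPolynomial.aeval (R := R) (vietaCoeff R r)).toRingHom with hφ
  have hX (i : Fin r) : φ.IsIntegralElem (MvPolynomial.X i) := by
    refine ⟨monicOfCoeffs r MvPolynomial.X, ?_, ?_⟩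
    · refine Polynomial.monic_X_pow_add ?_
      refine (Polynomial.degree_sum_le _ _).trans_lt ?_
      refine (Finset.sup_lt_iff (WithBot.bot_lt_coe r)).2 fun j _ => ?_
      exact (Polynomial.degree_C_mul_X_pow_le _ _).trans_lt (Nat.cast_lt.2 j.2)
    · have h := congrArg (Polynomial.eval (MvPolynomial.X i : MvPolynomial (Fin r) R))
        (monicOfCoeffs_vietaCoeff (R := R) (MvPolynomial.X : Fin r → MvPolynomial (Fin r) R))
      rw [eval_monicOfCoeffs, Polynomial.eval_prod,
        Finset.prod_eq_zero (Finset.mem_univ i) (by simp)] at h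
      rw [← h]
      simp [monicOfCoeffs, hφ, Polynomial.eval₂_finsetSum]
  intro p
  induction p using MvPolynomial.induction_on with
  | C c =>
    have : φ (MvPolynomial.C c) = MvPolynomial.C c := by simp [hφ, MvPolynomial.algebraMap_eq]
    rw [← this]; exact φ.isIntegralElem_map
  | add p q hp hq => exact hp.add φ hq
  | mul_X p j hp => exact hp.mul φ (hX j)

/-- The dimension does not increase when a set of coefficient vectors is replaced by a set of
vectors of roots. -/
theorem dimOf_le_of_vietaCoeff {K : Type*} [CommRing K] {r : ℕ} {Z W : Set (Fin r → K)}
    (h : ∀ x ∈ Z, (fun j => MvPolynomial.eval x (vietaCoeff K r j)) ∈ W) :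
    dimOf K r Z ≤ dimOf K r W := by
  set φ := (MvPolynomial.aeval (R := K) (vietaCoeff K r)).toRingHom with hφ
  have hle : vanishingIdealOf K r W ≤ (vanishingIdealOf K r Z).comap φ := by
    intro p hp x hx
    exact (eval_aeval _ x p).trans (hp _ (h x hx))
  refine ringKrullDim_le_of_isIntegral (Ideal.quotientMap _ φ hle) ?_
  refine RingHom.IsIntegral.tower_top (Ideal.Quotient.mk (vanishingIdealOf K r W)) _ ?_
  rw [Ideal.quotientMap_comp_mk]
  exact (isIntegral_aeval_vietaCoeff K r).trans _ _
    (RingHom.isIntegral_of_surjective _ Ideal.Quotient.mk_surjective)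

/-- Under hypotheses (H3) and (H6), the locus of points of the affine cone
`{R_1^{d_1} = ⋯ = R_m^{d_m} = 0}` at which the Jacobian of the highest-degree homogeneous
components `R_1^{d_1}, …, R_m^{d_m}` fails to have full rank has dimension at most
`r - m - 1`. -/
theorem singular_locus_at_infinity_codimension_one
    (Fq K : Type) [Field Fq] [Fintype Fq] [Field K] [Algebra Fq K] [IsAlgClosure Fq K]
    (r m : ℕ) (hm : 1 ≤ m) (hmr : m < r) (k : Fin r)
    (G : Fin m → MvPolynomial {j : Fin r // j ≠ k} Fq)
    -- the components of highest weight of `G_1, …, G_m` (for `wt(A_j) = r - j`)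
    (Gwt : Fin m → MvPolynomial {j : Fin r // j ≠ k} Fq)
    (hGwt : ∀ i, Gwt i = MvPolynomial.weightedHomogeneousComponent
        (fun j : {j : Fin r // j ≠ k} => r - (j.1 : ℕ))
        (MvPolynomial.weightedTotalDegree
          (fun j : {j : Fin r // j ≠ k} => r - (j.1 : ℕ)) (G i)) (G i))
    -- (H3): the highest-weight components also satisfy (H1) and (H2)
    (hH3reg : RingTheory.Sequence.IsRegular (MvPolynomial {j : Fin r // j ≠ k} Fq)
        (List.ofFn Gwt))
    (hH3rank : ∀ a : Fin r → K,
        (∀ i, MvPolynomial.eval (fun j : {j : Fin r // j ≠ k} => a j.1)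
          (MvPolynomial.map (algebraMap Fq K) (Gwt i)) = 0) →
        Matrix.rank (Matrix.of fun (i : Fin m) (j : {j : Fin r // j ≠ k}) =>
          MvPolynomial.eval (fun j' : {j : Fin r // j ≠ k} => a j'.1)
            (MvPolynomial.pderiv j (MvPolynomial.map (algebraMap Fq K) (Gwt i)))) = m)
    -- (H6): the non-squarefree locus of the variety at infinity has dimension `≤ r - m - 1`
    (hH6 : dimOf K r {a | (∀ i, MvPolynomial.eval (fun j : {j : Fin r // j ≠ k} => a j.1)
          (MvPolynomial.map (algebraMap Fq K) (Gwt i)) = 0)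
          ∧ ¬ Squarefree (monicOfCoeffs r a)} + 1 ≤ ((r - m : ℕ) : WithBot ℕ∞))
    -- the polynomials `R_i`, obtained from `G_i` by substituting `(-1)^(r-j) Π_(r-j)` for `A_j`
    (R : Fin m → MvPolynomial (Fin r) Fq)
    (hR : ∀ i, R i = MvPolynomial.aeval
        (fun j : {j : Fin r // j ≠ k} =>
          (-1 : MvPolynomial (Fin r) Fq) ^ (r - (j.1 : ℕ))
            * MvPolynomial.esymm (Fin r) Fq (r - (j.1 : ℕ))) (G i))
    -- `d_i` is the total degree of `R_i`, and `Rd i` its homogeneous component of degree `d_i`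
    (d : Fin m → ℕ) (hd : ∀ i, d i = (R i).totalDegree)
    (Rd : Fin m → MvPolynomial (Fin r) Fq)
    (hRd : ∀ i, Rd i = MvPolynomial.homogeneousComponent (d i) (R i)) :
    dimOf K r {x : Fin r → K |
        (∀ i, MvPolynomial.eval x (MvPolynomial.map (algebraMap Fq K) (Rd i)) = 0)
        ∧ Matrix.rank (Matrix.of fun (i : Fin m) (j : Fin r) =>
            MvPolynomial.eval x
              (MvPolynomial.pderiv j (MvPolynomial.map (algebraMap Fq K) (Rd i)))) < m} + 1
      ≤ ((r - m : ℕ) : WithBot ℕ∞) := by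
  have hRd' (i : Fin m) : MvPolynomial.map (algebraMap Fq K) (Rd i) =
      MvPolynomial.aeval (fun j : {j : Fin r // j ≠ k} => vietaCoeff K r j.1)
        (MvPolynomial.map (algebraMap Fq K) (Gwt i)) := by
    have h : Rd i = MvPolynomial.aeval (fun j : {j : Fin r // j ≠ k} => vietaCoeff Fq r j.1)
        (Gwt i) := by
      have hRi : R i = MvPolynomial.aeval
          (fun j : {j : Fin r // j ≠ k} => vietaCoeff Fq r j.1) (G i) := hR i
      rw [hRd, hd, hGwt, hRi]
      exact homogeneousComponent_totalDegree_aeval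
        (fun j : {j : Fin r // j ≠ k} => r - (j.1 : ℕ))
        (fun j : {j : Fin r // j ≠ k} => vietaCoeff Fq r j.1)
        (fun j => isHomogeneous_vietaCoeff Fq r j.1)
        ((algebraicIndependent_vietaCoeff Fq r).comp (fun j : {j : Fin r // j ≠ k} => j.1)
          Subtype.val_injective) (G i)
    rw [h, map_aeval_eq]
    simp only [map_vietaCoeff]
  refine le_trans (add_le_add_left (dimOf_le_of_vietaCoeff fun x hx => ?_) 1) hH6
  obtain ⟨hx0, hrank⟩ := hx
  simp only [hRd', eval_aeval] at hx0
  refine ⟨hx0, fun hsq => ?_⟩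
  have hinj : Function.Injective x := by
    have hprod := monicOfCoeffs_vietaCoeff (R := K) x
    change monicOfCoeffs r (fun j => MvPolynomial.eval x (vietaCoeff K r j)) = _ at hprod
    rw [hprod] at hsq
    exact injective_of_squarefree_prod_X_sub_C x hsq
  simp only [hRd'] at hrank
  have hfull := hH3rank (fun j => MvPolynomial.eval x (vietaCoeff K r j)) hx0
  have hle := rank_jacobian_le_rank_jacobian_aeval_vietaCoeff
    (fun i => MvPolynomial.map (algebraMap Fq K) (Gwt i)) x hinj
  rw [hfull] at hle
  exact absurd hrank (not_lt.2 hle)
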